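/- Let λ ∈ (0, λ₁) and γ > 0 be given. Then there exist β > 0 and a smooth function u on Ω̄ such that u(0) = γ and u solves Δu = λu + βu exp(u²) in Ω, with u > 0 in Ω and u = 0 on ∂Ω. -/

import Mathlib

open Real Set Filter MeasureTheory

noncomputable section

/-- The radial Laplacian with the sign convention Δ = −div(∇·):
for a radial C² function, (Δu)(r) = −u''(r) − u'(r)/r. -/
def radLap (u : ℝ → ℝ) (r : ℝ) : ℝ := -(deriv (deriv u) r) - deriv u r / r

/-- `EigenCtx lam1 v1` : λ₁ > 0 is the first radial Dirichlet eigenvalue of Δ = −div∇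
on the unit disk, with radial eigenfunction v₁. -/
def EigenCtx (lam1 : ℝ) (v1 : ℝ → ℝ) : Prop :=
  0 < lam1 ∧ ContDiffOn ℝ (⊤ : ℕ∞) v1 (Set.Icc 0 1) ∧
    (∀ r ∈ Set.Ioo (0:ℝ) 1, radLap v1 r = lam1 * v1 r) ∧
    (∀ r ∈ Set.Ico (0:ℝ) 1, 0 < v1 r) ∧ v1 1 = 0 ∧
    (∫ r in Set.Ioo (0:ℝ) 1, (v1 r) ^ 2 * (2 * π * r)) = 1

/-- `IsRadSol lam beta gam u` : u is a smooth radial function on the closed unit disk,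
positive in the open disk, vanishing on the boundary, with central value γ, solving
Δu = λu + βu e^{u²} in Ω (radially). -/
def IsRadSol (lam beta gam : ℝ) (u : ℝ → ℝ) : Prop :=
  ContDiffOn ℝ (⊤ : ℕ∞) u (Set.Icc 0 1) ∧
    (∀ r ∈ Set.Ioo (0:ℝ) 1,
      radLap u r = lam * u r + beta * u r * Real.exp ((u r) ^ 2)) ∧
    (∀ r ∈ Set.Ico (0:ℝ) 1, 0 < u r) ∧ u 1 = 0 ∧ u 0 = gam

lemma contDiff_integral_pow_mul_comp_mul (n : ℕ) :
    ∀ (m : ℕ) {k : ℝ → ℝ}, ContDiff ℝ n k →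
      ContDiff ℝ n fun s : ℝ => ∫ t in (0 : ℝ)..1, t ^ m * k (t * s) := by
  induction n with
  | zero =>
    intro m k hk
    have hk' : Continuous k := hk.continuous
    refine contDiff_zero.2 ?_
    exact intervalIntegral.continuous_parametric_intervalIntegral_of_continuous'
      (f := fun s t : ℝ => t ^ m * k (t * s)) (by fun_prop) 0 1
  | succ n ih =>
    intro m k hk
    have hk' : Continuous k := hk.continuous
    have hdiff : Differentiable ℝ k := hk.differentiable (by simp)
    have hdk : ContDiff ℝ n (deriv k) := (contDiff_succ_iff_deriv.1 hk).2.2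
    have hdk' : Continuous (deriv k) := hdk.continuous
    have hderiv : ∀ s : ℝ, HasDerivAt (fun s : ℝ => ∫ t in (0 : ℝ)..1, t ^ m * k (t * s))
        (∫ t in (0 : ℝ)..1, t ^ (m + 1) * deriv k (t * s)) s := by
      intro s
      obtain ⟨C, hC⟩ := (isCompact_Icc (a := -(|s| + 1)) (b := |s| + 1)).exists_bound_of_continuousOn
        hdk'.continuousOn
      refine (intervalIntegral.hasDerivAt_integral_of_dominated_loc_of_deriv_le (bound := fun _ => C)
        (F := fun s t : ℝ => t ^ m * k (t * s)) (F' := fun s t : ℝ => t ^ (m + 1) * deriv k (t * s))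
        (Metric.ball_mem_nhds s one_pos) (.of_forall fun x => ?_) ?_ ?_ ?_
        intervalIntegrable_const ?_).2
      · exact Continuous.aestronglyMeasurable (by fun_prop)
      · exact Continuous.intervalIntegrable (by fun_prop) _ _
      · exact Continuous.aestronglyMeasurable (by fun_prop)
      · refine .of_forall fun t ht x hx => ?_
        rw [uIoc_of_le zero_le_one] at ht
        rw [Metric.mem_ball, Real.dist_eq] at hx
        have hx' : |x| ≤ |s| + 1 := by
          have := abs_sub_abs_le_abs_sub x s
          linarith
        have htx : |t * x| ≤ |s| + 1 := by
          rw [abs_mul, abs_of_pos ht.1]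
          nlinarith [ht.2, abs_nonneg x]
        have h1 : ‖t ^ (m + 1)‖ ≤ 1 := by
          rw [norm_pow, Real.norm_eq_abs, abs_of_pos ht.1]
          exact pow_le_one₀ ht.1.le ht.2
        rw [norm_mul]
        have := hC (t * x) (abs_le.1 htx)
        nlinarith [norm_nonneg (deriv k (t * x)), norm_nonneg (t ^ (m + 1))]
      · refine .of_forall fun t _ x _ => ?_
        have h := ((hdiff (t * x)).hasDerivAt.comp x ((hasDerivAt_id x).const_mul t)).const_mul
          (t ^ m)
        exact h.congr_deriv (by ring)
    push_cast
    refine contDiff_succ_iff_deriv.2 ⟨fun s => (hderiv s).differentiableAt, by simp, ?_⟩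
    rw [funext fun s => (hderiv s).deriv]
    exact ih (m + 1) hdk

/-- Continuous solutions of the integral form of `(s w')' = -G(w)`, `w 0 = γ`, are smooth. -/
lemma contDiff_of_radial_integral_eq {gam : ℝ} {G w : ℝ → ℝ} (hG : ContDiff ℝ (⊤ : ℕ∞) G)
    (hw : Continuous w)
    (heq : ∀ s, w s = gam - ∫ σ in (0 : ℝ)..s, ∫ t in (0 : ℝ)..1, G (w (t * σ))) :
    (∀ s, HasDerivAt w (-∫ t in (0 : ℝ)..1, G (w (t * s))) s) ∧ ContDiff ℝ (⊤ : ℕ∞) w := by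
  have hGc : Continuous G := hG.continuous
  have hc : Continuous fun σ : ℝ => ∫ t in (0 : ℝ)..1, G (w (t * σ)) :=
    intervalIntegral.continuous_parametric_intervalIntegral_of_continuous'
      (f := fun s t : ℝ => G (w (t * s))) (by fun_prop) 0 1
  have hderiv : ∀ s, HasDerivAt w (-∫ t in (0 : ℝ)..1, G (w (t * s))) s := by
    intro s
    exact ((hc.integral_hasStrictDerivAt 0 s).hasDerivAt.const_sub gam).congr_of_eventuallyEq
      (.of_forall heq)
  refine ⟨hderiv, contDiff_infty.2 fun n => ?_⟩
  induction n with
  | zero => exact contDiff_zero.2 hw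
  | succ n ih =>
    push_cast
    refine contDiff_succ_iff_deriv.2 ⟨fun s => (hderiv s).differentiableAt, by simp, ?_⟩
    rw [funext fun s => (hderiv s).deriv]
    have hGn : ContDiff ℝ n G := hG.of_le (by exact_mod_cast le_top)
    have := contDiff_integral_pow_mul_comp_mul n 0 (hGn.comp ih)
    simpa using this.neg

open BoundedContinuousFunction in
/-- Global solvability of the integral form of `(s w')' = -F p w`, `w 0 = γ`, continuously in the
parameter `p`. -/
lemma exists_radial_family (gam : ℝ) {F : ℝ → ℝ → ℝ} (hF : Continuous (Function.uncurry F))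
    {M L : ℝ} (hM : ∀ p u, |F p u| ≤ M) (hL0 : 0 ≤ L)
    (hL : ∀ p u v, |F p u - F p v| ≤ L * |u - v|) :
    ∃ W : ℝ → ℝ → ℝ, Continuous (Function.uncurry W) ∧
      ∀ p s, W p s = gam - ∫ σ in (0 : ℝ)..s, ∫ t in (0 : ℝ)..1, F p (W p (t * σ)) := by
  set K : ℝ := L + 1 with hK
  have hK0 : 0 < K := by positivity
  let V (y : ℝ × ℝ →ᵇ ℝ) (p s : ℝ) : ℝ := exp (K * |s|) * y (p, s)
  let D (y : ℝ × ℝ →ᵇ ℝ) (p s : ℝ) : ℝ :=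
    ∫ θ in (0 : ℝ)..1, ∫ t in (0 : ℝ)..1, F p (V y p (t * (θ * s)))
  have hV : ∀ y, Continuous fun q : ℝ × ℝ => V y q.1 q.2 := fun y => by
    have := y.continuous
    fun_prop
  have hFV : ∀ y, Continuous fun q : ((ℝ × ℝ) × ℝ) × ℝ =>
      F q.1.1.1 (V y q.1.1.1 (q.2 * (q.1.2 * q.1.1.2))) := fun y => by
    have h : Continuous fun q : ((ℝ × ℝ) × ℝ) × ℝ =>
        V y q.1.1.1 (q.2 * (q.1.2 * q.1.1.2)) :=
      (hV y).comp (g := fun q : ℝ × ℝ => V y q.1 q.2)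
        (f := fun q : ((ℝ × ℝ) × ℝ) × ℝ => (q.1.1.1, q.2 * (q.1.2 * q.1.1.2))) (by fun_prop)
    exact hF.comp ((by fun_prop : Continuous fun q : ((ℝ × ℝ) × ℝ) × ℝ => q.1.1.1).prodMk h)
  have hI : ∀ y, Continuous fun q : (ℝ × ℝ) × ℝ =>
      ∫ t in (0 : ℝ)..1, F q.1.1 (V y q.1.1 (t * (q.2 * q.1.2))) := fun y =>
    intervalIntegral.continuous_parametric_intervalIntegral_of_continuous'
      (f := fun (q : (ℝ × ℝ) × ℝ) t => F q.1.1 (V y q.1.1 (t * (q.2 * q.1.2)))) (hFV y) 0 1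
  have hD : ∀ y, Continuous fun q : ℝ × ℝ => D y q.1 q.2 := fun y =>
    intervalIntegral.continuous_parametric_intervalIntegral_of_continuous'
      (f := fun (q : ℝ × ℝ) θ => ∫ t in (0 : ℝ)..1, F q.1 (V y q.1 (t * (θ * q.2)))) (hI y) 0 1
  have hDM : ∀ y p s, |D y p s| ≤ M := fun y p s => by
    have := intervalIntegral.norm_integral_le_of_norm_le_const (a := 0) (b := 1) (C := M)
      (f := fun θ => ∫ t in (0 : ℝ)..1, F p (V y p (t * (θ * s)))) fun θ _ => by
        have := intervalIntegral.norm_integral_le_of_norm_le_const (a := 0) (b := 1) (C := M)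
          (f := fun t => F p (V y p (t * (θ * s)))) fun t _ => hM _ _
        simpa using this
    simpa using this
  have hexp : ∀ s : ℝ, exp (-(K * |s|)) * |s| ≤ 1 / K := fun s => by
    rw [exp_neg, inv_mul_le_iff₀ (exp_pos _)]
    have := add_one_le_exp (K * |s|)
    rw [mul_one_div, le_div_iff₀ hK0]
    linarith
  have hDdiff : ∀ y z p s, |s| * |D y p s - D z p s| ≤
      L / K * dist y z * exp (K * |s|) := fun y z p s => by
    have hin : ∀ θ ∈ Ioc (0 : ℝ) 1, ‖(∫ t in (0 : ℝ)..1, F p (V y p (t * (θ * s)))) -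
        ∫ t in (0 : ℝ)..1, F p (V z p (t * (θ * s)))‖ ≤
          L * dist y z * exp (K * |s| * θ) := fun θ hθ => by
      have hcont : ∀ y, Continuous fun t => F p (V y p (t * (θ * s))) := fun y =>
        (hFV y).comp (by fun_prop : Continuous fun t : ℝ => (((p, s), θ), t))
      rw [← intervalIntegral.integral_sub ((hcont y).intervalIntegrable _ _)
        ((hcont z).intervalIntegrable _ _)]
      have := intervalIntegral.norm_integral_le_of_norm_le_const (a := 0) (b := 1)
        (C := L * dist y z * exp (K * |s| * θ))
        (f := fun t => F p (V y p (t * (θ * s))) - F p (V z p (t * (θ * s)))) fun t ht => by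
          rw [uIoc_of_le zero_le_one] at ht
          refine (hL _ _ _).trans ?_
          have h1 : |V y p (t * (θ * s)) - V z p (t * (θ * s))| ≤
              exp (K * |s| * θ) * dist y z := by
            simp only [V]
            rw [← mul_sub, abs_mul, abs_of_pos (exp_pos _)]
            refine mul_le_mul (exp_le_exp.2 ?_) (by
                rw [← Real.dist_eq]
                exact BoundedContinuousFunction.dist_coe_le_dist _)
              (abs_nonneg _) (exp_pos _).le
            rw [abs_mul, abs_mul, abs_of_pos ht.1, abs_of_pos hθ.1, mul_assoc]
            refine mul_le_mul_of_nonneg_left ?_ hK0.le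
            nlinarith [ht.2, mul_nonneg hθ.1.le (abs_nonneg s)]
          calc L * _ ≤ L * (exp (K * |s| * θ) * dist y z) := mul_le_mul_of_nonneg_left h1 hL0
            _ = _ := by ring
      simpa using this
    have hcont : ∀ y, Continuous fun θ => ∫ t in (0 : ℝ)..1, F p (V y p (t * (θ * s))) :=
      fun y => (hI y).comp (by fun_prop : Continuous fun θ : ℝ => ((p, s), θ))
    have hout : |D y p s - D z p s| ≤ ∫ θ in (0 : ℝ)..1, L * dist y z * exp (K * |s| * θ) := by
      simp only [D]
      rw [← intervalIntegral.integral_sub ((hcont y).intervalIntegrable _ _)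
        ((hcont z).intervalIntegrable _ _)]
      exact intervalIntegral.norm_integral_le_of_norm_le zero_le_one
        (.of_forall fun θ hθ => hin θ hθ) (Continuous.intervalIntegrable (by fun_prop) _ _)
    have hint : |s| * ∫ θ in (0 : ℝ)..1, L * dist y z * exp (K * |s| * θ) =
        L / K * dist y z * (exp (K * |s|) - 1) := by
      rw [← intervalIntegral.integral_const_mul, intervalIntegral.integral_eq_sub_of_hasDerivAt
        (f := fun θ => L / K * dist y z * exp (K * |s| * θ))]
      · simp; ring
      · intro θ _
        have h := (((hasDerivAt_id θ).const_mul (K * |s|)).exp).const_mul (L / K * dist y z)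
        refine h.congr_deriv ?_
        simp only [id]
        field_simp
      · exact Continuous.intervalIntegrable (by fun_prop) _ _
    have hLd : 0 ≤ L / K * dist y z := by positivity
    calc |s| * _ ≤ |s| * ∫ θ in (0 : ℝ)..1, L * dist y z * exp (K * |s| * θ) :=
          mul_le_mul_of_nonneg_left hout (abs_nonneg s)
      _ = L / K * dist y z * (exp (K * |s|) - 1) := hint
      _ ≤ _ := mul_le_mul_of_nonneg_left (by linarith) hLd
  let T (y : ℝ × ℝ →ᵇ ℝ) : ℝ × ℝ →ᵇ ℝ :=
    BoundedContinuousFunction.ofNormedAddCommGroup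
      (fun q => exp (-(K * |q.2|)) * (gam - q.2 * D y q.1 q.2))
      (by have := hD y; fun_prop) (|gam| + 1 / K * M) fun q => by
        have h1 : exp (-(K * |q.2|)) ≤ 1 := exp_le_one_iff.2 (by
          have := mul_nonneg hK0.le (abs_nonneg q.2)
          linarith)
        have h2 := hexp q.2
        have h3 := hDM y q.1 q.2
        rw [norm_mul, Real.norm_eq_abs, abs_of_pos (exp_pos _), Real.norm_eq_abs]
        calc _ ≤ exp (-(K * |q.2|)) * (|gam| + |q.2| * |D y q.1 q.2|) := by
              gcongr
              rw [← abs_mul]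
              exact abs_sub _ _
          _ = exp (-(K * |q.2|)) * |gam| + exp (-(K * |q.2|)) * |q.2| * |D y q.1 q.2| := by ring
          _ ≤ 1 * |gam| + 1 / K * M := by gcongr
          _ = _ := by ring
  have hT : ContractingWith (L / K).toNNReal T := by
    constructor
    · rw [Real.toNNReal_lt_one, div_lt_one hK0]
      linarith
    · refine LipschitzWith.of_dist_le_mul fun y z => ?_
      rw [Real.coe_toNNReal _ (by positivity)]
      refine (BoundedContinuousFunction.dist_le (by positivity)).2 fun q => ?_
      rw [Real.dist_eq]
      change |exp (-(K * |q.2|)) * (gam - q.2 * D y q.1 q.2) -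
        exp (-(K * |q.2|)) * (gam - q.2 * D z q.1 q.2)| ≤ _
      rw [← mul_sub, abs_mul, abs_of_pos (exp_pos _), exp_neg, inv_mul_le_iff₀ (exp_pos _)]
      have h := hDdiff y z q.1 q.2
      rw [← abs_mul] at h
      rw [← abs_neg, show -(gam - q.2 * D y q.1 q.2 - (gam - q.2 * D z q.1 q.2)) =
        q.2 * (D y q.1 q.2 - D z q.1 q.2) by ring]
      linarith
  set y := hT.fixedPoint T with hy
  have hfix : T y = y := hT.fixedPoint_isFixedPt
  refine ⟨V y, hV y, fun p s => ?_⟩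
  have h1 : V y p s = gam - s * D y p s := by
    have : y (p, s) = exp (-(K * |s|)) * (gam - s * D y p s) := by
      conv_lhs => rw [← hfix]
      rfl
    simp only [V]
    rw [this, ← mul_assoc, ← exp_add]
    simp
  rw [h1]
  congr 1
  have := intervalIntegral.mul_integral_comp_mul_right (a := 0) (b := 1)
    (f := fun σ => ∫ t in (0 : ℝ)..1, F p (V y p (t * σ))) s
  simpa [D] using this

/-- The differential form of the integral equation. -/
lemma radial_ode_of_hasDerivAt {G w : ℝ → ℝ} (hG : Continuous G) (hw : ContDiff ℝ (⊤ : ℕ∞) w)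
    (hderiv : ∀ s, HasDerivAt w (-∫ t in (0 : ℝ)..1, G (w (t * s))) s) (s : ℝ) :
    deriv w s + s * deriv (deriv w) s = -G (w s) := by
  have hwc : Continuous w := hw.continuous
  have hprod : (fun s => s * deriv w s) = fun s => -∫ σ in (0 : ℝ)..s, G (w σ) := by
    funext s
    rw [(hderiv s).deriv, mul_neg, intervalIntegral.mul_integral_comp_mul_right
      (f := fun σ => G (w σ))]
    simp
  have hd : DifferentiableAt ℝ (deriv w) s :=
    ((contDiff_infty_iff_deriv.1 hw).2.differentiable (by simp)) s
  have h1 : HasDerivAt (fun s => s * deriv w s) (1 * deriv w s + s * deriv (deriv w) s) s :=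
    (hasDerivAt_id s).mul hd.hasDerivAt
  rw [hprod] at h1
  have h2 : HasDerivAt (fun s => -∫ σ in (0 : ℝ)..s, G (w σ)) (-G (w s)) s :=
    ((hG.comp hwc).integral_hasStrictDerivAt 0 s).hasDerivAt.neg
  simpa using h1.unique h2

lemma antitoneOn_of_radial_deriv {G w : ℝ → ℝ} (hw : Continuous w)
    (hderiv : ∀ s, HasDerivAt w (-∫ t in (0 : ℝ)..1, G (w (t * s))) s)
    (hG0 : ∀ u, 0 ≤ u → 0 ≤ G u) (hw0 : ∀ s ∈ Icc (0 : ℝ) 1, 0 ≤ w s) :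
    AntitoneOn w (Icc 0 1) := by
  refine antitoneOn_of_deriv_nonpos (convex_Icc 0 1) hw.continuousOn
    (fun s _ => (hderiv s).differentiableAt.differentiableWithinAt) fun s hs => ?_
  rw [interior_Icc] at hs
  rw [(hderiv s).deriv, neg_nonpos]
  refine intervalIntegral.integral_nonneg zero_le_one fun t ht => hG0 _ (hw0 _ ⟨?_, ?_⟩)
  · exact mul_nonneg ht.1 hs.1.le
  · exact mul_le_one₀ ht.2 hs.1.le hs.2.le

lemma strictAntiOn_of_radial_deriv {G w : ℝ → ℝ} (hG : Continuous G) (hw : Continuous w)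
    (hderiv : ∀ s, HasDerivAt w (-∫ t in (0 : ℝ)..1, G (w (t * s))) s)
    (hG0 : ∀ u, 0 ≤ u → 0 ≤ G u) (hw0 : ∀ s ∈ Icc (0 : ℝ) 1, 0 ≤ w s) (hpos : 0 < G (w 0)) :
    StrictAntiOn w (Icc 0 1) := by
  refine strictAntiOn_of_deriv_neg (convex_Icc 0 1) hw.continuousOn fun s hs => ?_
  rw [interior_Icc] at hs
  rw [(hderiv s).deriv, neg_lt_zero]
  refine intervalIntegral.integral_pos zero_lt_one
    (Continuous.continuousOn (by fun_prop)) (fun t ht => hG0 _ (hw0 _ ⟨?_, ?_⟩))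
    ⟨0, by simp, by simpa using hpos⟩
  · exact mul_nonneg ht.1.le hs.1.le
  · exact mul_le_one₀ ht.2 hs.1.le hs.2.le

/-- The weighted Wronskian of `r ↦ w (r ^ 2)` and the first eigenfunction. -/
lemma exists_wronskian {lam1 : ℝ} {v1 : ℝ → ℝ} (hE : EigenCtx lam1 v1) {G w : ℝ → ℝ}
    (hw : ContDiff ℝ (⊤ : ℕ∞) w)
    (hode : ∀ s, deriv w s + s * deriv (deriv w) s = -G (w s)) :
    ∃ Φ : ℝ → ℝ, ContinuousOn Φ (Icc 0 1) ∧ Φ 0 = 0 ∧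
      (∀ r ∈ Ioo (0 : ℝ) 1,
        HasDerivAt Φ (r * v1 r * (lam1 * w (r ^ 2) - 4 * G (w (r ^ 2)))) r) ∧
      ∃ c, 0 ≤ c ∧ Φ 1 = c * w 1 := by
  obtain ⟨-, hv, heq, hvpos, hv1, -⟩ := hE
  have hu : UniqueDiffOn ℝ (Icc (0 : ℝ) 1) := uniqueDiffOn_Icc zero_lt_one
  have hwc : Continuous w := hw.continuous
  have hdw : Continuous (deriv w) := hw.continuous_deriv (by simp)
  have hdv : ContinuousOn (derivWithin v1 (Icc 0 1)) (Icc 0 1) :=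
    hv.continuousOn_derivWithin hu (by simp)
  refine ⟨fun r => 2 * r ^ 2 * deriv w (r ^ 2) * v1 r - r * w (r ^ 2) * derivWithin v1 (Icc 0 1) r,
    ?_, by simp, fun r hr => ?_, -derivWithin v1 (Icc 0 1) 1, ?_, by simp [hv1]; ring⟩
  · have hvc := hv.continuousOn
    refine ContinuousOn.sub (ContinuousOn.mul (Continuous.continuousOn (by fun_prop)) hvc)
      (ContinuousOn.mul (Continuous.continuousOn (by fun_prop)) hdv)
  · have hnhds : Icc (0 : ℝ) 1 ∈ nhds r := Icc_mem_nhds hr.1 hr.2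
    have hvr : ContDiffAt ℝ (⊤ : ℕ∞) v1 r := hv.contDiffAt hnhds
    have hv' : HasDerivAt v1 (deriv v1 r) r := (hvr.differentiableAt (by simp)).hasDerivAt
    have hv'' : HasDerivAt (derivWithin v1 (Icc 0 1)) (deriv (deriv v1) r) r := by
      have h : DifferentiableAt ℝ (derivWithin v1 (Icc 0 1)) r :=
        ((hv.derivWithin (m := 1) hu (by norm_cast)).contDiffAt hnhds).differentiableAt
          (by simp)
      have hev : derivWithin v1 (Icc 0 1) =ᶠ[nhds r] deriv v1 := by
        filter_upwards [Ioo_mem_nhds hr.1 hr.2] with x hx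
        exact derivWithin_of_mem_nhds (Icc_mem_nhds hx.1 hx.2)
      exact hev.deriv_eq ▸ h.hasDerivAt
    have hsq : HasDerivAt (fun r : ℝ => r ^ 2) (2 * r) r := by simpa using hasDerivAt_pow 2 r
    have hw' : HasDerivAt (fun r => w (r ^ 2)) (deriv w (r ^ 2) * (2 * r)) r :=
      ((hw.differentiable (by simp)) (r ^ 2)).hasDerivAt.comp r hsq
    have hw'' : HasDerivAt (fun r => deriv w (r ^ 2)) (deriv (deriv w) (r ^ 2) * (2 * r)) r :=
      HasDerivAt.comp (h₂ := deriv w) r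
        (((contDiff_infty_iff_deriv.1 hw).2.differentiable (by simp)) (r ^ 2)).hasDerivAt hsq
    have h := (((hsq.const_mul 2).mul hw'').mul hv').sub (((hasDerivAt_id r).mul hw').mul hv'')
    refine h.congr_deriv ?_
    have hr0 : r ≠ 0 := hr.1.ne'
    have heqr : deriv (deriv v1) r * r + deriv v1 r = -(lam1 * v1 r * r) := by
      have := heq r hr
      simp only [radLap] at this
      field_simp at this
      linarith
    have hdr : derivWithin v1 (Icc 0 1) r = deriv v1 r := derivWithin_of_mem_nhds hnhds
    simp only [hdr, Pi.mul_apply, id]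
    linear_combination (4 * r * v1 r) * hode (r ^ 2) - w (r ^ 2) * heqr
  · have hmin : IsLocalMinOn v1 (Icc 0 1) 1 := by
      refine IsMinOn.localize fun x hx => ?_
      rcases hx.2.lt_or_eq with h | h
      · simpa [hv1] using (hvpos x ⟨hx.1, h⟩).le
      · simp [h]
    have hd := ((hv.differentiableOn (by simp)) 1 (by simp)).hasDerivWithinAt
    have := hmin.hasFDerivWithinAt_nonneg hd.hasFDerivWithinAt (y := -1) (by
      have := sub_mem_posTangentConeAt_of_segment_subset (s := Icc (0 : ℝ) 1) (x := 1) (y := 0)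
        (by rw [segment_symm, segment_eq_Icc zero_le_one])
      simpa using this)
    simpa using this

/-- A smooth radial profile in `s = r ^ 2` gives a radial solution. -/
lemma isRadSol_comp_sq {lam beta gam : ℝ} {G w : ℝ → ℝ} (hw : ContDiff ℝ (⊤ : ℕ∞) w)
    (hode : ∀ s, deriv w s + s * deriv (deriv w) s = -G (w s))
    (hG : ∀ s ∈ Icc (0 : ℝ) 1, 4 * G (w s) = lam * w s + beta * w s * exp (w s ^ 2))
    (hpos : ∀ s ∈ Ico (0 : ℝ) 1, 0 < w s) (h1 : w 1 = 0) (h0 : w 0 = gam) :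
    IsRadSol lam beta gam fun r => w (r ^ 2) := by
  refine ⟨(hw.comp (contDiff_id.pow 2)).contDiffOn, fun r hr => ?_, fun r hr => ?_,
    by simpa using h1, by simpa using h0⟩
  · have hsq : ∀ r : ℝ, HasDerivAt (fun r : ℝ => r ^ 2) (2 * r) r := fun r => by
      simpa using hasDerivAt_pow 2 r
    have hw' : ∀ r, HasDerivAt (fun r => w (r ^ 2)) (deriv w (r ^ 2) * (2 * r)) r := fun r =>
      ((hw.differentiable (by simp)) (r ^ 2)).hasDerivAt.comp r (hsq r)
    have hw'' : HasDerivAt (fun r => deriv w (r ^ 2)) (deriv (deriv w) (r ^ 2) * (2 * r)) r :=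
      HasDerivAt.comp (h₂ := deriv w) r
        (((contDiff_infty_iff_deriv.1 hw).2.differentiable (by simp)) (r ^ 2)).hasDerivAt (hsq r)
    have h2 := (hw''.mul ((hasDerivAt_id r).const_mul 2)).deriv
    have hr0 : r ≠ 0 := hr.1.ne'
    have hGr := hG (r ^ 2) ⟨sq_nonneg r, pow_le_one₀ hr.1.le hr.2.le⟩
    rw [radLap, funext fun r => (hw' r).deriv]
    change -deriv ((fun r => deriv w (r ^ 2)) * fun r => 2 * id r) r - _ = _
    rw [h2, ← hGr]
    have : deriv w (r ^ 2) * (2 * r) / r = 2 * deriv w (r ^ 2) := by field_simp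
    simp only [this, id]
    linear_combination -4 * hode (r ^ 2)
  · exact hpos _ ⟨sq_nonneg r, pow_lt_one₀ hr.1 hr.2 two_ne_zero⟩

lemma exists_abs_le_and_lipschitz {g : ℝ → ℝ} (hg : ContDiff ℝ (⊤ : ℕ∞) g)
    (hc : HasCompactSupport g) :
    ∃ C, 0 ≤ C ∧ (∀ u, |g u| ≤ C) ∧ ∀ u v, |g u - g v| ≤ C * |u - v| := by
  obtain ⟨M, hM⟩ := hc.exists_bound_of_continuous hg.continuous
  obtain ⟨L, hL⟩ := hg.lipschitzWith_of_hasCompactSupport hc (by simp)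
  refine ⟨max M L, le_max_of_le_right L.2, fun u => (hM u).trans (le_max_left _ _), fun u v => ?_⟩
  have := hL.dist_le_mul u v
  rw [Real.dist_eq, Real.dist_eq] at this
  exact this.trans (mul_le_mul_of_nonneg_right (le_max_right _ _) (abs_nonneg _))

/-- Lemma 1 of the paper. For λ ∈ (0,λ₁) and γ > 0 there exist β > 0
and a smooth u with u(0) = γ solving Δu = λu + βu e^{u²}, u > 0 in Ω, u = 0 on ∂Ω. -/
theorem statement3 (lam1 : ℝ) (v1 : ℝ → ℝ) (hE : EigenCtx lam1 v1)
    (lam gam : ℝ) (hlam0 : 0 < lam) (hlam1 : lam < lam1) (hgam : 0 < gam) :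
    ∃ beta : ℝ, 0 < beta ∧ ∃ u : ℝ → ℝ, IsRadSol lam beta gam u := by
  have hlam1_pos : 0 < lam1 := hE.1
  have hv1pos := hE.2.2.2.1
  let φ : ContDiffBump (0 : ℝ) := ⟨gam, gam + 1, hgam, by linarith⟩
  have hφ : ContDiff ℝ (⊤ : ℕ∞) φ := φ.contDiff
  have hφ1 : ∀ u, 0 ≤ u → u ≤ gam → φ u = 1 := fun u h0 h1 =>
    φ.one_of_mem_closedBall (by simpa [abs_of_nonneg h0] using h1)
  let g₁ (u : ℝ) : ℝ := lam / 4 * u * φ u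
  let g₂ (u : ℝ) : ℝ := 1 / 4 * u * exp (u ^ 2) * φ u
  have hg₁ : ContDiff ℝ (⊤ : ℕ∞) g₁ := by fun_prop
  have hg₂ : ContDiff ℝ (⊤ : ℕ∞) g₂ := by fun_prop
  obtain ⟨C₁, hC₁, hb₁, hl₁⟩ := exists_abs_le_and_lipschitz hg₁ φ.hasCompactSupport.mul_left
  obtain ⟨C₂, hC₂, hb₂, hl₂⟩ := exists_abs_le_and_lipschitz hg₂ φ.hasCompactSupport.mul_left
  let a (p : ℝ) : ℝ := max 0 (min p 1)
  let b (p : ℝ) : ℝ := max 0 (min (p - 1) lam1)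
  have ha0 : ∀ p, 0 ≤ a p := fun p => le_max_left _ _
  have hb0 : ∀ p, 0 ≤ b p := fun p => le_max_left _ _
  have ha1 : ∀ p, a p ≤ 1 := fun p => max_le zero_le_one (min_le_right _ _)
  have hb1 : ∀ p, b p ≤ lam1 := fun p => max_le hlam1_pos.le (min_le_right _ _)
  have hcomb : ∀ p x y, |a p * x + b p * y| ≤ |x| + lam1 * |y| := fun p x y => by
    refine (abs_add_le _ _).trans ?_
    rw [abs_mul, abs_mul, abs_of_nonneg (ha0 p), abs_of_nonneg (hb0 p)]
    have h1 := mul_le_mul_of_nonneg_right (ha1 p) (abs_nonneg x)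
    have h2 := mul_le_mul_of_nonneg_right (hb1 p) (abs_nonneg y)
    linarith
  let F (p u : ℝ) : ℝ := a p * g₁ u + b p * g₂ u
  have hFc : Continuous (Function.uncurry F) := by
    have := hg₁.continuous
    have := hg₂.continuous
    change Continuous fun q : ℝ × ℝ => max 0 (min q.1 1) * g₁ q.2 +
      max 0 (min (q.1 - 1) lam1) * g₂ q.2
    fun_prop
  have hFs : ∀ p, ContDiff ℝ (⊤ : ℕ∞) (F p) := fun p =>
    (contDiff_const.mul hg₁).add (contDiff_const.mul hg₂)
  obtain ⟨W, hWc, hW⟩ := exists_radial_family gam hFc (M := C₁ + lam1 * C₂)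
    (L := C₁ + lam1 * C₂)
    (fun p u => (hcomb p _ _).trans
      (add_le_add (hb₁ u) (mul_le_mul_of_nonneg_left (hb₂ u) hlam1_pos.le)))
    (by positivity) (fun p u v => by
      rw [show F p u - F p v = a p * (g₁ u - g₁ v) + b p * (g₂ u - g₂ v) by
        simp only [F]; ring]
      refine (hcomb p _ _).trans ?_
      have h1 := hl₁ u v
      have h2 := mul_le_mul_of_nonneg_left (hl₂ u v) hlam1_pos.le
      linarith)
  have hWp : ∀ p, Continuous (W p) := fun p => hWc.comp (by fun_prop : Continuous fun s => (p, s))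
  have hderiv := fun p => (contDiff_of_radial_integral_eq (hFs p) (hWp p) (hW p)).1
  have hsmooth := fun p => (contDiff_of_radial_integral_eq (hFs p) (hWp p) (hW p)).2
  have hode := fun p => radial_ode_of_hasDerivAt (hFs p).continuous (hsmooth p) (hderiv p)
  have hW0 : ∀ p, W p 0 = gam := fun p => by simpa using hW p 0
  have hF0 : ∀ p u, 0 ≤ u → 0 ≤ F p u := fun p u hu => by
    have := φ.nonneg (x := u)
    have := ha0 p
    have := hb0 p
    positivity
  have hFeq : ∀ p u, 0 ≤ u → u ≤ gam →
      4 * F p u = a p * lam * u + b p * u * exp (u ^ 2) := fun p u h0 h1 => by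
    simp only [F, g₁, g₂, hφ1 u h0 h1]
    ring
  have ha_pos : ∀ p, 0 < p → 0 < a p := fun p hp => lt_max_of_lt_right (lt_min hp one_pos)
  let A : Set ℝ := {p | p ∈ Icc 0 (1 + lam1) ∧ ∀ s ∈ Icc (0 : ℝ) 1, 0 ≤ W p s}
  have hanti : ∀ p ∈ A, AntitoneOn (W p) (Icc 0 1) := fun p hp =>
    antitoneOn_of_radial_deriv (hWp p) (hderiv p) (hF0 p) hp.2
  have hle : ∀ p ∈ A, ∀ s ∈ Icc (0 : ℝ) 1, W p s ≤ gam := fun p hp s hs =>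
    (hanti p hp (by simp) hs hs.1).trans_eq (hW0 p)
  have hpos : ∀ p ∈ A, 0 < p → ∀ s ∈ Ico (0 : ℝ) 1, 0 < W p s := fun p hp hp0 s hs => by
    have hFpos : 0 < F p (W p 0) := by
      have h := hFeq p gam hgam.le le_rfl
      have := mul_pos (mul_pos (ha_pos p hp0) hlam0) hgam
      have := mul_nonneg (mul_nonneg (hb0 p) hgam.le) (exp_pos (gam ^ 2)).le
      rw [hW0]
      linarith
    exact (hp.2 1 (by simp)).trans_lt (strictAntiOn_of_radial_deriv (hFs p).continuous (hWp p)
      (hderiv p) (hF0 p) hp.2 hFpos ⟨hs.1, hs.2.le⟩ (by simp) hs.2)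
  have hsq : ∀ r ∈ Ioo (0 : ℝ) 1, r ^ 2 ∈ Ico (0 : ℝ) 1 := fun r hr =>
    ⟨sq_nonneg r, pow_lt_one₀ hr.1.le hr.2 two_ne_zero⟩
  have htop : 1 + lam1 ∉ A := fun hp => by
    obtain ⟨Φ, hΦc, hΦ0, hΦ', c, hc, hΦ1⟩ := exists_wronskian hE (hsmooth _) (hode (1 + lam1))
    have hstrict : StrictAntiOn Φ (Icc 0 1) := by
      refine strictAntiOn_of_deriv_neg (convex_Icc 0 1) hΦc fun r hr => ?_
      rw [interior_Icc] at hr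
      rw [(hΦ' r hr).deriv]
      have hs := hsq r hr
      have hw := hpos _ hp (by linarith) _ hs
      refine mul_neg_of_pos_of_neg (mul_pos hr.1 (hv1pos r ⟨hr.1.le, hr.2⟩)) ?_
      rw [hFeq _ _ hw.le (hle _ hp _ ⟨hs.1, hs.2.le⟩)]
      have hbt : b (1 + lam1) = lam1 := by simp [b, hlam1_pos.le]
      rw [hbt]
      have h1 := mul_pos (mul_pos (ha_pos (1 + lam1) (by linarith)) hlam0) hw
      have h2 := mul_le_mul_of_nonneg_left
        (one_le_exp (sq_nonneg (W (1 + lam1) (r ^ 2)))) (mul_pos hlam1_pos hw).le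
      linarith
    have h := hstrict (by simp : (0 : ℝ) ∈ Icc (0 : ℝ) 1) (by simp : (1 : ℝ) ∈ Icc (0 : ℝ) 1)
      one_pos
    have := mul_nonneg hc (hp.2 1 (by simp))
    linarith
  have hzero : ∀ s, W 0 s = gam := fun s => by
    have hF : ∀ u, F 0 u = 0 := fun u => by simp [F, a, b]
    rw [hW]
    simp [hF]
  have hAc : IsCompact A := by
    refine isCompact_Icc.inter_right (t := {p | ∀ s ∈ Icc (0 : ℝ) 1, 0 ≤ W p s}) ?_
    simp only [ofPred_forall]
    refine isClosed_biInter fun s _ => isClosed_le continuous_const ?_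
    exact hWc.comp (by fun_prop : Continuous fun p : ℝ => (p, s))
  obtain ⟨p, hpA, hmax⟩ := hAc.exists_isGreatest
    ⟨0, ⟨le_rfl, by linarith⟩, fun s _ => by rw [hzero]; exact hgam.le⟩
  have hp1 : W p 1 = 0 := by
    by_contra hne
    have hlt : 0 < W p 1 := lt_of_le_of_ne (hpA.2 1 (by simp)) (Ne.symm hne)
    have hptop : p < 1 + lam1 := lt_of_le_of_ne hpA.1.2 fun h => htop (h ▸ hpA)
    have hev : ∀ᶠ p' in nhds p, ∀ s ∈ Icc (0 : ℝ) 1, 0 < W p' s := by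
      refine isCompact_Icc.eventually_forall_of_forall_eventually fun s hs => ?_
      exact hWc.continuousAt.eventually_const_lt
        (hlt.trans_le (hanti p hpA hs (by simp) hs.2))
    obtain ⟨p', hp', hIoc⟩ := ((hev.filter_mono nhdsWithin_le_nhds).and
      (Ioc_mem_nhdsGT hptop)).exists
    exact absurd (hmax ⟨⟨hpA.1.1.trans hIoc.1.le, hIoc.2⟩, fun s hs => (hp' s hs).le⟩)
      (not_le.2 hIoc.1)
  have hp0 : 0 < p := by
    refine lt_of_le_of_ne hpA.1.1 fun h => ?_
    rw [← h, hzero] at hp1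
    exact hgam.ne' hp1
  have hp_gt : 1 < p := by
    by_contra! hple
    obtain ⟨Φ, hΦc, hΦ0, hΦ', c, -, hΦ1⟩ := exists_wronskian hE (hsmooth _) (hode p)
    have hstrict : StrictMonoOn Φ (Icc 0 1) := by
      refine strictMonoOn_of_deriv_pos (convex_Icc 0 1) hΦc fun r hr => ?_
      rw [interior_Icc] at hr
      rw [(hΦ' r hr).deriv]
      have hs := hsq r hr
      have hw := hpos _ hpA hp0 _ hs
      refine mul_pos (mul_pos hr.1 (hv1pos r ⟨hr.1.le, hr.2⟩)) ?_
      rw [hFeq _ _ hw.le (hle _ hpA _ ⟨hs.1, hs.2.le⟩)]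
      have hbp : b p = 0 := max_eq_left ((min_le_left _ _).trans (by linarith))
      rw [hbp]
      have h1 := mul_le_mul_of_nonneg_right (ha1 p) (mul_pos hlam0 hw).le
      have h2 := mul_lt_mul_of_pos_right hlam1 hw
      linarith
    have h := hstrict (by simp : (0 : ℝ) ∈ Icc (0 : ℝ) 1) (by simp : (1 : ℝ) ∈ Icc (0 : ℝ) 1)
      one_pos
    rw [hΦ0, hΦ1, hp1, mul_zero] at h
    exact lt_irrefl _ h
  refine ⟨p - 1, by linarith, fun r => W p (r ^ 2),
    isRadSol_comp_sq (hsmooth p) (hode p) (fun s hs => ?_) (hpos p hpA hp0) hp1 (hW0 p)⟩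
  have hap : a p = 1 := by simp [a, hp_gt.le]
  have hbp : b p = p - 1 := by
    have := hpA.1.2
    simp only [b]
    rw [min_eq_left (by linarith), max_eq_right (by linarith)]
  rw [hFeq p _ (hpA.2 s hs) (hle p hpA s hs), hap, hbp, one_mul]

end
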